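/- Semidefinite description of the trigonometric moment body: the convex hull of M_N = {(qqᵀ, qqᵀcos ω, qqᵀsin ω, ..., qqᵀcos Nω, qqᵀsin Nω) : q ∈ ℝ⁴, ‖q‖=1, ω ∈ [−π,π)} equals the set of tuples (X₀, X₁, Y₁, ..., X_N, Y_N) of 4×4 symmetric matrices with tr(X₀) = 1 and Toeplitz(X₀, X₁, ..., X_N) + Hankel(Y_N, Y_{N−1}, ..., Y₁, 0, −Y₁, ..., −Y_{N−1}, −Y_N) ⪰ 0. -/

import Mathlib

open Matrix

/-- Block Toeplitz matrix with blocks `T 0, T 1, ..., T N` (transposed below the block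
diagonal). -/
def blockToeplitz (d N : ℕ) (T : ℕ → Matrix (Fin d) (Fin d) ℝ) :
    Matrix (Fin (N + 1) × Fin d) (Fin (N + 1) × Fin d) ℝ :=
  fun p q =>
    if p.1.1 ≤ q.1.1 then T (q.1.1 - p.1.1) p.2 q.2 else (T (p.1.1 - q.1.1))ᵀ p.2 q.2

/-- Block Hankel matrix with blocks `s 1, ..., s (2N+1)`: block `(j,k)` (1-indexed) is
`s (j+k-1)`. -/
def blockHankel (d N : ℕ) (s : ℕ → Matrix (Fin d) (Fin d) ℝ) :
    Matrix (Fin (N + 1) × Fin d) (Fin (N + 1) × Fin d) ℝ :=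
  fun p q => s (p.1.1 + q.1.1 + 1) p.2 q.2

/-- A tuple `(X₀, X₁, Y₁, ..., X_N, Y_N)` is encoded as a pair of families
`v = (X, Y)` with `X n` and `Y n` for `n = 0, ..., N`, where `Y 0 = 0`. -/
def trigMomentSet (N : ℕ) :
    Set ((Fin (N + 1) → Matrix (Fin 4) (Fin 4) ℝ) ×
      (Fin (N + 1) → Matrix (Fin 4) (Fin 4) ℝ)) :=
  {v | ∃ (q : Fin 4 → ℝ) (ω : ℝ), (∑ i, q i ^ 2 = 1) ∧ ω ∈ Set.Ico (-Real.pi) Real.pi ∧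
    ∀ n : Fin (N + 1), v.1 n = Real.cos (n * ω) • vecMulVec q q ∧
      v.2 n = Real.sin (n * ω) • vecMulVec q q}


section TrigMomentHelpers

lemma tm_eigenbasis {E : Type*} [NormedAddCommGroup E] [InnerProductSpace ℂ E]
    [FiniteDimensional ℂ E] (W : E →ₗᵢ[ℂ] E) :
    ∃ (b : OrthonormalBasis (Fin (Module.finrank ℂ E)) ℂ E)
      (l : Fin (Module.finrank ℂ E) → ℂ), ∀ e, W (b e) = l e • b e := by
  classical
  let T : E →ₗ[ℂ] E := W.toLinearMap
  let S : E →ₗ[ℂ] E := LinearMap.adjoint T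
  have hST : S * T = 1 := by
    ext x
    refine ext_inner_left ℂ fun y => ?_
    simp only [Module.End.mul_apply, Module.End.one_apply, S]
    rw [LinearMap.adjoint_inner_right]
    exact W.inner_map_map y x
  have hTS : T * S = 1 := mul_eq_one_comm.mp hST
  have hTa : ∀ x y, inner ℂ (T x) y = inner ℂ x (S y) := fun x y =>
    (LinearMap.adjoint_inner_right T x y).symm
  have hSa : ∀ x y, inner ℂ (S x) y = inner ℂ x (T y) := fun x y =>
    LinearMap.adjoint_inner_left T y x
  let A : E →ₗ[ℂ] E := T + S
  let B : E →ₗ[ℂ] E := Complex.I • (S - T)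
  have hA : A.IsSymmetric := by
    intro x y
    simp [A, inner_add_left, inner_add_right, hTa, hSa]
    ring
  have hB : B.IsSymmetric := by
    intro x y
    simp [B, inner_sub_left, inner_sub_right, inner_smul_left, inner_smul_right, hTa, hSa]
    ring
  have hAB : Commute A B := by
    change A * B = B * A
    simp only [A, B, mul_smul_comm, smul_mul_assoc]
    congr 1
    simp only [add_mul, mul_add, mul_sub, sub_mul, hST, hTS]
    abel
  have hI := LinearMap.IsSymmetric.directSum_isInternal_of_commute hA hB hAB
  have hO := LinearMap.IsSymmetric.orthogonalFamily_eigenspace_inf_eigenspace hA hB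
  have hfin := WellFoundedGT.finite_ne_bot_of_iSupIndep hI.submodule_iSupIndep
  have hI' := DirectSum.isInternal_ne_bot_iff.mpr hI
  have hO' := hO.comp (γ := {i // (Module.End.eigenspace A i.2 ⊓ Module.End.eigenspace B i.1) ≠ ⊥})
    Subtype.val_injective
  have : Fintype {i : ℂ × ℂ // (Module.End.eigenspace A i.2 ⊓ Module.End.eigenspace B i.1) ≠ ⊥} :=
    @Fintype.ofFinite _ hfin
  refine ⟨hI'.subordinateOrthonormalBasis rfl hO',
    fun e => ((hI'.subordinateOrthonormalBasisIndex rfl e hO').1.2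
      + Complex.I * (hI'.subordinateOrthonormalBasisIndex rfl e hO').1.1) / 2, fun e => ?_⟩
  beta_reduce
  have hm := hI'.subordinateOrthonormalBasis_subordinate rfl e hO'
  generalize (hI'.subordinateOrthonormalBasis rfl hO') e = x at *
  generalize hI'.subordinateOrthonormalBasisIndex rfl e hO' = g at *
  obtain ⟨h1, h2⟩ := Submodule.mem_inf.mp hm
  rw [Module.End.mem_eigenspace_iff] at h1 h2
  have h3 : (2 : ℂ) • W x = A x + Complex.I • B x := by
    change (2 : ℂ) • T x = A x + Complex.I • B x
    simp only [A, B, LinearMap.add_apply, LinearMap.smul_apply, LinearMap.sub_apply, smul_smul,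
      Complex.I_mul_I]
    module
  rw [h1, h2] at h3
  have h4 : W x = (2 : ℂ)⁻¹ • ((2 : ℂ) • W x) := by simp [smul_smul]
  rw [h4, h3]
  module

lemma tm_extend {E V : Type*} [NormedAddCommGroup E] [InnerProductSpace ℂ E]
    [FiniteDimensional ℂ E] [AddCommGroup V] [Module ℂ V]
    (f g : V →ₗ[ℂ] E) (h : ∀ x, ‖f x‖ = ‖g x‖) :
    ∃ W : E →ₗᵢ[ℂ] E, ∀ x, W (f x) = g x := by
  obtain ⟨k, hk⟩ := f.rangeRestrict.exists_rightInverse_of_surjective f.range_rangeRestrict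
  have hk' : ∀ y : LinearMap.range f, f (k y) = y := fun y => by
    have := LinearMap.congr_fun hk y
    simpa using congrArg Subtype.val this
  let L : LinearMap.range f →ₗᵢ[ℂ] E :=
    { toLinearMap := g ∘ₗ k
      norm_map' := fun y => by
        rw [LinearMap.comp_apply, ← h, hk']; rfl }
  refine ⟨L.extend, fun x => ?_⟩
  have h1 := L.extend_apply ⟨f x, LinearMap.mem_range_self f x⟩
  rw [h1]
  change g (k ⟨f x, _⟩) = g x
  rw [← sub_eq_zero, ← map_sub, ← norm_eq_zero, ← h, map_sub, hk']
  simp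

lemma tm_shift {E ι : Type*} [NormedAddCommGroup E] [InnerProductSpace ℂ E]
    [FiniteDimensional ℂ E] [Fintype ι] (N : ℕ) (v : ℕ → ι → E)
    (h : ∀ p q i j, p < N → q < N →
      inner ℂ (v p i) (v q j) = inner ℂ (v (p + 1) i) (v (q + 1) j)) :
    ∃ W : E →ₗᵢ[ℂ] E, ∀ p i, p < N → W (v p i) = v (p + 1) i := by
  classical
  obtain ⟨W, hW⟩ := tm_extend
    (Fintype.linearCombination ℂ (fun x : Fin N × ι => v x.1 x.2))
    (Fintype.linearCombination ℂ (fun x : Fin N × ι => v (x.1 + 1) x.2)) (fun x => by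
      have : ∀ u : Fin N × ι → E, ‖Fintype.linearCombination ℂ u x‖ ^ 2 =
          RCLike.re (∑ a, ∑ b, (starRingEnd ℂ) (x a) * (x b * inner ℂ (u a) (u b))) := by
        intro u
        rw [@norm_sq_eq_re_inner ℂ]
        simp only [Fintype.linearCombination_apply, sum_inner, inner_sum, inner_smul_left,
          inner_smul_right]
        congr 1
        rw [Finset.sum_comm]
        refine Finset.sum_congr rfl fun a _ => ?_
        simp only [Finset.mul_sum]
        refine Finset.sum_congr rfl fun b _ => ?_
        ring
      rw [← sq_eq_sq₀ (norm_nonneg _) (norm_nonneg _), this, this]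
      simp only [h _ _ _ _ (Fin.is_lt _) (Fin.is_lt _)])
  refine ⟨W, fun p i hp => ?_⟩
  have := hW (Pi.single (⟨p, hp⟩, i) 1)
  simpa using this

lemma tm_core {E ι : Type*} [NormedAddCommGroup E] [InnerProductSpace ℂ E]
    [FiniteDimensional ℂ E] [Fintype ι] (N : ℕ) (v : ℕ → ι → E)
    (h : ∀ p q i j, p < N → q < N →
      inner ℂ (v p i) (v q j) = inner ℂ (v (p + 1) i) (v (q + 1) j)) :
    ∃ (n : ℕ) (l : Fin n → ℂ) (c : Fin n → ι → ℂ), (∀ e, ‖l e‖ = 1) ∧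
      ∀ q i j, q ≤ N → inner ℂ (v 0 i) (v q j) =
        ∑ e, l e ^ q * ((starRingEnd ℂ) (c e i) * c e j) := by
  obtain ⟨W, hW⟩ := tm_shift N v h
  obtain ⟨b, l, hl⟩ := tm_eigenbasis W
  have hl1 : ∀ e, ‖l e‖ = 1 := fun e => by
    have := W.norm_map (b e)
    rw [hl, norm_smul] at this
    simpa using this
  have hin : ∀ e x, inner ℂ (b e) (W x) = l e * inner ℂ (b e) x := by
    intro e x
    have h1 := W.inner_map_map (b e) x
    rw [hl, inner_smul_left] at h1
    rw [← h1, ← mul_assoc, Complex.mul_conj, Complex.normSq_eq_norm_sq, hl1]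
    simp
  have hq : ∀ q, q ≤ N → ∀ e j, inner ℂ (b e) (v q j) = l e ^ q * inner ℂ (b e) (v 0 j) := by
    intro q
    induction q with
    | zero => intro _ e j; simp
    | succ q ih =>
      intro hq e j
      rw [← hW q j (by omega), hin, ih (by omega), pow_succ]
      ring
  refine ⟨_, l, fun e i => inner ℂ (b e) (v 0 i), hl1, fun q i j hqN => ?_⟩
  rw [← b.sum_inner_mul_inner]
  refine Finset.sum_congr rfl fun e _ => ?_
  rw [hq q hqN, inner_conj_symm]
  ring

lemma tm_gram {K : Type*} [Fintype K] [DecidableEq K] (M : Matrix K K ℝ) (hM : M.PosSemidef) :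
    ∃ C : Matrix K K ℝ, ∀ a b, M a b = ∑ k, C k a * C k b := by
  open scoped MatrixOrder in
  obtain ⟨C, hC⟩ := CStarAlgebra.nonneg_iff_eq_star_mul_self.mp hM.nonneg
  refine ⟨C, fun a b => ?_⟩
  rw [hC]
  simp [Matrix.mul_apply, Matrix.star_eq_conjTranspose]

/-- Ambient space of tuples. -/
abbrev TMV (N : ℕ) := (Fin (N + 1) → Matrix (Fin 4) (Fin 4) ℝ) ×
      (Fin (N + 1) → Matrix (Fin 4) (Fin 4) ℝ)

lemma tm_lt1 {N m : ℕ} (h : 1 ≤ m ∧ m ≤ N) : N + 1 - m < N + 1 := by omega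

lemma tm_lt2 {N m : ℕ} (h : N + 1 ≤ m ∧ m ≤ 2 * N + 1) : m - (N + 1) < N + 1 := by omega

/-- The big block matrix. -/
def tmM (N : ℕ) (v : TMV N) : Matrix (Fin (N + 1) × Fin 4) (Fin (N + 1) × Fin 4) ℝ :=
  blockToeplitz 4 N (fun n =>
            if h : n ≤ N then v.1 ⟨n, Nat.lt_succ_of_le h⟩ else 0) +
          blockHankel 4 N (fun m =>
            if h : 1 ≤ m ∧ m ≤ N then v.2 ⟨N + 1 - m, tm_lt1 h⟩
            else if h2 : N + 1 ≤ m ∧ m ≤ 2 * N + 1 then -(v.2 ⟨m - (N + 1), tm_lt2 h2⟩)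
            else 0)

/-- Even extension of the `X` family. -/
def tmX (N : ℕ) (v : TMV N) (k : ℤ) : Matrix (Fin 4) (Fin 4) ℝ :=
  if h : k.natAbs ≤ N then v.1 ⟨k.natAbs, Nat.lt_succ_of_le h⟩ else 0

/-- Odd extension of the `Y` family. -/
def tmY (N : ℕ) (v : TMV N) (k : ℤ) : Matrix (Fin 4) (Fin 4) ℝ :=
  if h : k.natAbs ≤ N then
    (if 0 < k then v.2 ⟨k.natAbs, Nat.lt_succ_of_le h⟩
      else -v.2 ⟨k.natAbs, Nat.lt_succ_of_le h⟩) else 0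

lemma tmX_neg (N : ℕ) (v : TMV N) (k : ℤ) : tmX N v (-k) = tmX N v k := by
  simp [tmX]

lemma tmY_neg (N : ℕ) (v : TMV N) (h0 : v.2 0 = 0) (k : ℤ) : tmY N v (-k) = -tmY N v k := by
  unfold tmY
  by_cases hk : k.natAbs ≤ N
  · rcases lt_trichotomy k 0 with h | h | h
    · simp [hk, h, h.not_gt]
    · subst h
      have : (⟨0, Nat.succ_pos N⟩ : Fin (N + 1)) = 0 := rfl
      simp [this, h0]
    · simp [hk, h, h.not_gt]
  · simp [hk]

lemma tmX_natCast (N : ℕ) (v : TMV N) (n : ℕ) (h : n ≤ N) :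
    tmX N v n = v.1 ⟨n, Nat.lt_succ_of_le h⟩ := by
  simp [tmX, h]

lemma tmY_natCast (N : ℕ) (v : TMV N) (h0 : v.2 0 = 0) (n : ℕ) (h : n ≤ N) :
    tmY N v n = v.2 ⟨n, Nat.lt_succ_of_le h⟩ := by
  rcases Nat.eq_zero_or_pos n with rfl | hn
  · have : (⟨0, Nat.succ_pos N⟩ : Fin (N + 1)) = 0 := rfl
    simp [tmY, this, h0]
  · simp [tmY, h, hn]

lemma tmM_apply (N : ℕ) (v : TMV N) (hs : ∀ n, (v.1 n).IsSymm)
    (p q : ℕ) (hp : p ≤ N) (hq : q ≤ N) (i j : Fin 4) :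
    tmM N v (⟨p, Nat.lt_succ_of_le hp⟩, i) (⟨q, Nat.lt_succ_of_le hq⟩, j) =
      tmX N v ((q : ℤ) - p) i j + tmY N v ((N : ℤ) - p - q) i j := by
  unfold tmM
  rw [Matrix.add_apply]
  unfold blockToeplitz blockHankel tmX tmY
  congr 1
  · simp only
    have h1 : ((q : ℤ) - p).natAbs ≤ N := by omega
    rw [dif_pos h1]
    by_cases h : p ≤ q
    · have h2 : q - p ≤ N := by omega
      have h3 : ((q : ℤ) - p).natAbs = q - p := by omega
      simp [h, h2, h3]
    · have h2 : p - q ≤ N := by omega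
      have h3 : ((q : ℤ) - p).natAbs = p - q := by omega
      rw [if_neg h, dif_pos h2, hs]
      simp only [h3]
  · simp only
    have h1 : ((N : ℤ) - p - q).natAbs ≤ N := by omega
    rw [dif_pos h1]
    by_cases h : p + q < N
    · have h2 : (1 ≤ p + q + 1 ∧ p + q + 1 ≤ N) := by omega
      have h4 : 0 < (N : ℤ) - p - q := by omega
      have h3 : ((N : ℤ) - p - q).natAbs = N + 1 - (p + q + 1) := by omega
      rw [dif_pos h2, if_pos h4]
      simp only [h3]
    · have h2 : ¬ (1 ≤ p + q + 1 ∧ p + q + 1 ≤ N) := by omega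
      have h5 : (N + 1 ≤ p + q + 1 ∧ p + q + 1 ≤ 2 * N + 1) := by omega
      have h4 : ¬ 0 < (N : ℤ) - p - q := by omega
      have h3 : ((N : ℤ) - p - q).natAbs = (p + q + 1) - (N + 1) := by omega
      rw [dif_neg h2, dif_pos h5, if_neg h4]
      simp only [h3]

lemma tmM_lin (N : ℕ) (v w : TMV N) (a b : ℝ) :
    tmM N (a • v + b • w) = a • tmM N v + b • tmM N w := by
  ext ⟨p, i⟩ ⟨q, j⟩
  simp only [tmM, blockToeplitz, blockHankel, Matrix.add_apply, Matrix.smul_apply, smul_eq_mul]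
  split_ifs <;> simp <;> ring

/-- The spectrahedron. -/
def tmS (N : ℕ) : Set (TMV N) :=
  {v | (∀ n, (v.1 n).IsSymm ∧ (v.2 n).IsSymm) ∧ v.2 0 = 0 ∧ (v.1 0).trace = 1 ∧
        (tmM N v).PosSemidef}

lemma tmS_convex (N : ℕ) : Convex ℝ (tmS N) := by
  rintro v ⟨hv1, hv2, hv3, hv4⟩ w ⟨hw1, hw2, hw3, hw4⟩ a b ha hb hab
  refine ⟨fun n => ⟨?_, ?_⟩, ?_, ?_, ?_⟩
  · exact ((hv1 n).1.smul a).add ((hw1 n).1.smul b)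
  · exact ((hv1 n).2.smul a).add ((hw1 n).2.smul b)
  · simp [hv2, hw2]
  · simp [hv3, hw3, hab]
  · rw [tmM_lin]
    exact (hv4.smul ha).add (hw4.smul hb)

lemma tm_vec_symm (q : Fin 4 → ℝ) : (vecMulVec q q).IsSymm := by
  ext i j
  simp [vecMulVec_apply, mul_comm]

lemma tm_subset (N : ℕ) : trigMomentSet N ⊆ tmS N := by
  rintro v ⟨q, ω, hq, -, hv⟩
  have hX : ∀ k : ℤ, k.natAbs ≤ N → tmX N v k = Real.cos (k * ω) • vecMulVec q q := by
    intro k hk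
    rw [tmX, dif_pos hk, (hv _).1]
    congr 1
    rcases abs_choice (k : ℝ) with h | h <;> simp [h, Nat.cast_natAbs]
  have hY : ∀ k : ℤ, k.natAbs ≤ N → tmY N v k = Real.sin (k * ω) • vecMulVec q q := by
    intro k hk
    rw [tmY, dif_pos hk, (hv _).2]
    split_ifs with h
    · have : (0 : ℝ) < k := by exact_mod_cast h
      simp [Nat.cast_natAbs, abs_of_pos this]
    · have : (k : ℝ) ≤ 0 := by exact_mod_cast not_lt.mp h
      rw [← neg_smul]
      simp [Nat.cast_natAbs, abs_of_nonpos this]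
  have hs : ∀ n, (v.1 n).IsSymm ∧ (v.2 n).IsSymm := fun n => by
    rw [(hv n).1, (hv n).2]
    exact ⟨(tm_vec_symm q).smul _, (tm_vec_symm q).smul _⟩
  refine ⟨hs, ?_, ?_, ?_⟩
  · rw [(hv 0).2]; simp
  · rw [(hv 0).1]
    simp only [Matrix.trace, diag_apply, Matrix.smul_apply, vecMulVec_apply, ← sq]
    simpa using hq
  · let u : Fin (N + 1) × Fin 4 → ℝ := fun a =>
      (Real.cos (((a.1 : ℕ) - (N : ℝ) / 2) * ω) - Real.sin (((a.1 : ℕ) - (N : ℝ) / 2) * ω)) * q a.2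
    have : tmM N v = vecMulVec u (star u) := by
      ext ⟨⟨p, hp⟩, i⟩ ⟨⟨r, hr⟩, j⟩
      rw [tmM_apply N v (fun n => (hs n).1) p r (by omega) (by omega), hX _ (by omega),
        hY _ (by omega)]
      have e1 : (((r : ℤ) - p : ℤ) : ℝ) * ω = (r - (N : ℝ) / 2) * ω - (p - (N : ℝ) / 2) * ω := by
        push_cast; ring
      have e2 : (((N : ℤ) - p - r : ℤ) : ℝ) * ω =
          -((r - (N : ℝ) / 2) * ω + (p - (N : ℝ) / 2) * ω) := by
        push_cast; ring
      rw [e1, e2, Real.cos_sub, Real.sin_neg, Real.sin_add]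
      simp only [Matrix.smul_apply, vecMulVec_apply, u, smul_eq_mul, star_trivial]
      ring
    rw [this]
    exact posSemidef_vecMulVec_self_star u

/-- The atom with direction `q` (not normalized) and angle `ω`. -/
noncomputable def tmAtom (N : ℕ) (q : Fin 4 → ℝ) (ω : ℝ) : TMV N :=
  (fun n => Real.cos (n * ω) • vecMulVec q q, fun n => Real.sin (n * ω) • vecMulVec q q)

lemma tmAtom_eq (N : ℕ) (q : Fin 4 → ℝ) (ω : ℝ) (hω : ω ∈ Set.Ico (-Real.pi) Real.pi) :
    ∃ x ∈ trigMomentSet N, tmAtom N q ω = (∑ i, q i ^ 2) • x := by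
  by_cases h : ∑ i, q i ^ 2 = 0
  · have hq : q = 0 := by
      ext i
      have := (Finset.sum_eq_zero_iff_of_nonneg (fun i _ => sq_nonneg (q i))).mp h i
        (Finset.mem_univ i)
      simpa using this
    refine ⟨tmAtom N (Pi.single 0 1) ω, ⟨Pi.single 0 1, ω, ?_, hω, fun n => ⟨rfl, rfl⟩⟩, ?_⟩
    · simp [Pi.single_apply]
    · rw [h, zero_smul, hq]
      ext n <;> simp [tmAtom]
  · have hpos : 0 < ∑ i, q i ^ 2 :=
      lt_of_le_of_ne (Finset.sum_nonneg fun i _ => sq_nonneg (q i)) (Ne.symm h)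
    set s := ∑ i, q i ^ 2 with hsdef
    have hss : Real.sqrt s ^ 2 = s := Real.sq_sqrt hpos.le
    have hs0 : Real.sqrt s ≠ 0 := (Real.sqrt_pos.mpr hpos).ne'
    refine ⟨tmAtom N ((Real.sqrt s)⁻¹ • q) ω, ⟨_, ω, ?_, hω, fun n => ⟨rfl, rfl⟩⟩, ?_⟩
    · simp only [Pi.smul_apply, smul_eq_mul, mul_pow]
      rw [← Finset.mul_sum, ← hsdef, inv_pow, hss, inv_mul_cancel₀ h]
    · have : s • vecMulVec ((Real.sqrt s)⁻¹ • q) ((Real.sqrt s)⁻¹ • q) = vecMulVec q q := by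
        ext i j
        simp only [Matrix.smul_apply, vecMulVec_apply, Pi.smul_apply, smul_eq_mul]
        calc s * ((Real.sqrt s)⁻¹ * q i * ((Real.sqrt s)⁻¹ * q j))
            = s * ((Real.sqrt s ^ 2)⁻¹) * (q i * q j) := by ring
          _ = q i * q j := by rw [hss, mul_inv_cancel₀ h, one_mul]
      refine Prod.ext (funext fun n => ?_) (funext fun n => ?_)
      · change _ = s • (Real.cos (n * ω) • vecMulVec ((Real.sqrt s)⁻¹ • q) ((Real.sqrt s)⁻¹ • q))
        rw [smul_comm, this]; rfl
      · change _ = s • (Real.sin (n * ω) • vecMulVec ((Real.sqrt s)⁻¹ • q) ((Real.sqrt s)⁻¹ • q))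
        rw [smul_comm, this]; rfl

lemma tm_angle (z : ℂ) (hz : ‖z‖ = 1) : ∃ ω ∈ Set.Ico (-Real.pi) Real.pi,
    ∀ n : ℕ, z ^ n = (Real.cos (n * ω) : ℂ) + (Real.sin (n * ω) : ℂ) * Complex.I := by
  have key : ∀ ω : ℝ, z = Complex.exp (ω * Complex.I) →
      ∀ n : ℕ, z ^ n = (Real.cos (n * ω) : ℂ) + (Real.sin (n * ω) : ℂ) * Complex.I := by
    intro ω h n
    rw [h, ← Complex.exp_nat_mul, ← mul_assoc, Complex.exp_mul_I]
    push_cast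
    rfl
  have h1 : z = Complex.exp (z.arg * Complex.I) := by
    have := Complex.norm_mul_exp_arg_mul_I z
    rw [hz] at this
    simpa using this.symm
  rcases (Complex.arg_le_pi z).lt_or_eq with h | h
  · exact ⟨z.arg, ⟨(Complex.neg_pi_lt_arg z).le, h⟩, key _ h1⟩
  · refine ⟨-Real.pi, ⟨le_rfl, by linarith [Real.pi_pos]⟩, key _ ?_⟩
    rw [h1, h]
    push_cast
    rw [neg_mul, Complex.exp_neg, Complex.exp_pi_mul_I]
    norm_num

lemma tm_superset (N : ℕ) : tmS N ⊆ convexHull ℝ (trigMomentSet N) := by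
  rintro v ⟨hs, h0, ht, hM⟩
  obtain ⟨C, hC⟩ := tm_gram _ hM
  let r : ℕ → Fin 4 → (Fin (N + 1) × Fin 4) → ℝ := fun p i k =>
    if h : p ≤ N then C k (⟨p, Nat.lt_succ_of_le h⟩, i) else 0
  have hr : ∀ p q i j, p ≤ N → q ≤ N → ∑ k, r p i k * r q j k =
      tmX N v ((q : ℤ) - p) i j + tmY N v ((N : ℤ) - p - q) i j := by
    intro p q i j hp hq
    rw [← tmM_apply N v (fun n => (hs n).1) p q hp hq, hC]
    simp [r, hp, hq]
  let w : ℕ → Fin 4 → EuclideanSpace ℂ (Fin (N + 1) × Fin 4) := fun p i =>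
    WithLp.toLp 2 (fun k => (r p i k : ℂ) + (r (N - p) i k : ℂ) * Complex.I)
  have hw : ∀ p q i j, p ≤ N → q ≤ N → inner ℂ (w p i) (w q j) =
      ((2 * tmX N v ((q : ℤ) - p) i j : ℝ) : ℂ) +
        ((2 * tmY N v ((q : ℤ) - p) i j : ℝ) : ℂ) * Complex.I := by
    intro p q i j hp hq
    have e1 := hr p q i j hp hq
    have e2 := hr (N - p) (N - q) i j (by omega) (by omega)
    have e3 := hr p (N - q) i j hp (by omega)
    have e4 := hr (N - p) q i j (by omega) hq
    rw [show (((N - q : ℕ) : ℤ) - (N - p : ℕ)) = -((q : ℤ) - p) by omega, tmX_neg,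
      show ((N : ℤ) - (N - p : ℕ) - (N - q : ℕ)) = -((N : ℤ) - p - q) by omega,
      tmY_neg N v h0] at e2
    rw [show ((N : ℤ) - p - (N - q : ℕ)) = ((q : ℤ) - p) by omega] at e3
    rw [show ((N : ℤ) - (N - p : ℕ) - q) = -((q : ℤ) - p) by omega, tmY_neg N v h0,
      show ((q : ℤ) - (N - p : ℕ)) = -(((N - q : ℕ) : ℤ) - p) by omega, tmX_neg] at e4
    have e5 : 2 * tmX N v ((q : ℤ) - p) i j =
        ∑ k, (r p i k * r q j k + r (N - p) i k * r (N - q) j k) := by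
      rw [Finset.sum_add_distrib, e1, e2, Matrix.neg_apply]; ring
    have e6 : 2 * tmY N v ((q : ℤ) - p) i j =
        ∑ k, (r p i k * r (N - q) j k - r (N - p) i k * r q j k) := by
      rw [Finset.sum_sub_distrib, e3, e4, Matrix.neg_apply]; ring
    rw [e5, e6, Complex.ofReal_sum, Complex.ofReal_sum, Finset.sum_mul, ← Finset.sum_add_distrib,
      PiLp.inner_apply]
    refine Finset.sum_congr rfl fun k _ => ?_
    simp only [w, RCLike.inner_apply, map_add, map_mul, Complex.conj_ofReal, Complex.conj_I]
    push_cast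
    linear_combination (-(r (N - p) i k : ℂ) * r (N - q) j k) * Complex.I_sq
  obtain ⟨n, l, c, hl, hlc⟩ := tm_core N w (by
    intro p q i j hp hq
    rw [hw p q i j hp.le hq.le, hw (p + 1) (q + 1) i j hp hq]
    rw [show (((q + 1 : ℕ) : ℤ) - (p + 1 : ℕ)) = (q : ℤ) - p by push_cast; ring])
  choose ω hω hωl using fun e => tm_angle (l e) (hl e)
  have hfin : ∀ m i j, (hm : m ≤ N) →
      v.1 ⟨m, Nat.lt_succ_of_le hm⟩ i j = ∑ e, Real.cos (m * ω e) * (2⁻¹ *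
        ((c e i).re * (c e j).re + (c e i).im * (c e j).im)) ∧
      v.2 ⟨m, Nat.lt_succ_of_le hm⟩ i j = ∑ e, Real.sin (m * ω e) * (2⁻¹ *
        ((c e i).re * (c e j).re + (c e i).im * (c e j).im)) := by
    intro m i j hm
    have h1 : ∀ i j, ((2 * v.1 ⟨m, Nat.lt_succ_of_le hm⟩ i j : ℝ) : ℂ) +
        ((2 * v.2 ⟨m, Nat.lt_succ_of_le hm⟩ i j : ℝ) : ℂ) * Complex.I =
        ∑ e, l e ^ m * ((starRingEnd ℂ) (c e i) * c e j) := by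
      intro i j
      rw [← hlc m i j hm, hw 0 m i j (Nat.zero_le _) hm]
      rw [show ((m : ℤ) - (0 : ℕ)) = m by simp, tmX_natCast N v m hm, tmY_natCast N v h0 m hm]
    have h2 := h1 i j
    have h3 := h1 j i
    rw [(hs _).1.apply, (hs _).2.apply] at h3
    have h4 := congrArg₂ (· + ·) h2 h3
    simp only [← Finset.sum_add_distrib] at h4
    have h5 : ∀ e, l e ^ m * ((starRingEnd ℂ) (c e i) * c e j) +
        l e ^ m * ((starRingEnd ℂ) (c e j) * c e i) =
        ((Real.cos (m * ω e) * (2 *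
          ((c e i).re * (c e j).re + (c e i).im * (c e j).im)) : ℝ) : ℂ) +
        ((Real.sin (m * ω e) * (2 *
          ((c e i).re * (c e j).re + (c e i).im * (c e j).im)) : ℝ) : ℂ) * Complex.I := by
      intro e
      have : (starRingEnd ℂ) (c e i) * c e j + (starRingEnd ℂ) (c e j) * c e i =
          ((2 * ((c e i).re * (c e j).re + (c e i).im * (c e j).im) : ℝ) : ℂ) := by
        apply Complex.ext
        · simp; ring
        · simp; ring
      rw [← mul_add, this, hωl]
      push_cast
      ring
    simp only [h5] at h4
    rw [Finset.sum_add_distrib, ← Finset.sum_mul, ← Complex.ofReal_sum, ← Complex.ofReal_sum] at h4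
    have hre := congrArg Complex.re h4
    have him := congrArg Complex.im h4
    simp only [Complex.add_re, Complex.add_im, Complex.re_ofReal_mul, Complex.im_ofReal_mul,
      Complex.ofReal_re, Complex.ofReal_im, Complex.I_re, Complex.I_im, mul_zero, mul_one,
      add_zero, zero_add] at hre him
    constructor
    · have : ∀ e, Real.cos (m * ω e) * (2⁻¹ *
          ((c e i).re * (c e j).re + (c e i).im * (c e j).im)) = 4⁻¹ * (Real.cos (m * ω e) * (2 *
          ((c e i).re * (c e j).re + (c e i).im * (c e j).im))) := fun e => by ring
      simp only [this]
      rw [← Finset.mul_sum, ← hre]; ring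
    · have : ∀ e, Real.sin (m * ω e) * (2⁻¹ *
          ((c e i).re * (c e j).re + (c e i).im * (c e j).im)) = 4⁻¹ * (Real.sin (m * ω e) * (2 *
          ((c e i).re * (c e j).re + (c e i).im * (c e j).im))) := fun e => by ring
      simp only [this]
      rw [← Finset.mul_sum, ← him]; ring
  let Q : Fin n × Bool → Fin 4 → ℝ := fun a i => if a.2 then (c a.1 i).re else (c a.1 i).im
  choose x hx hxq using fun a : Fin n × Bool => tmAtom_eq N (Q a) (ω a.1) (hω a.1)
  have hv : v = ∑ a, (2⁻¹ * ∑ i, Q a i ^ 2) • x a := by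
    simp only [mul_smul, ← hxq]
    refine Prod.ext (funext fun m => ?_) (funext fun m => ?_)
    · ext i j
      have := (hfin m i j (by omega)).1
      simp only [Fin.eta] at this
      rw [this]
      simp only [Prod.fst_sum, Finset.sum_apply, Matrix.sum_apply, Fintype.sum_prod_type,
        Fintype.sum_bool]
      refine Finset.sum_congr rfl fun e _ => ?_
      simp [tmAtom, Q, vecMulVec_apply]
      ring
    · ext i j
      have := (hfin m i j (by omega)).2
      simp only [Fin.eta] at this
      rw [this]
      simp only [Prod.snd_sum, Finset.sum_apply, Matrix.sum_apply, Fintype.sum_prod_type,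
        Fintype.sum_bool]
      refine Finset.sum_congr rfl fun e _ => ?_
      simp [tmAtom, Q, vecMulVec_apply]
      ring
  rw [hv]
  refine (convex_convexHull ℝ _).sum_mem (fun a _ => ?_) ?_
    (fun a _ => subset_convexHull ℝ _ (hx a))
  · have := Finset.sum_nonneg (s := Finset.univ) fun i _ => sq_nonneg (Q a i)
    positivity
  · rw [← ht, Matrix.trace]
    have h2 : ∀ i, (v.1 0) i i = ∑ a, 2⁻¹ * Q a i ^ 2 := by
      intro i
      have := (hfin 0 i i (Nat.zero_le _)).1
      have e0 : (⟨0, Nat.lt_succ_of_le (Nat.zero_le N)⟩ : Fin (N + 1)) = 0 := rfl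
      rw [e0] at this
      rw [this, Fintype.sum_prod_type]
      refine Finset.sum_congr rfl fun e _ => ?_
      simp [Q]
      ring
    simp only [diag_apply, h2, Finset.mul_sum]
    rw [Finset.sum_comm]

end TrigMomentHelpers

/-- semidefinite description of the trigonometric moment body
(Proposition 1 of the paper): `conv(M_N)` equals the set of tuples of symmetric
matrices with `tr X₀ = 1` and
`Toeplitz(X₀,...,X_N) + Hankel(Y_N,...,Y₁,0,−Y₁,...,−Y_N) ⪰ 0`. -/
theorem convexHull_trigMomentSet (N : ℕ) :
    convexHull ℝ (trigMomentSet N) =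
      {v : (Fin (N + 1) → Matrix (Fin 4) (Fin 4) ℝ) ×
          (Fin (N + 1) → Matrix (Fin 4) (Fin 4) ℝ) |
        (∀ n, (v.1 n).IsSymm ∧ (v.2 n).IsSymm) ∧ v.2 0 = 0 ∧ (v.1 0).trace = 1 ∧
        (blockToeplitz 4 N (fun n =>
            if h : n ≤ N then v.1 ⟨n, Nat.lt_succ_of_le h⟩ else 0) +
          blockHankel 4 N (fun m =>
            if h : 1 ≤ m ∧ m ≤ N then v.2 ⟨N + 1 - m, by omega⟩
            else if h2 : N + 1 ≤ m ∧ m ≤ 2 * N + 1 then -(v.2 ⟨m - (N + 1), by omega⟩)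
            else 0)).PosSemidef} := by
  change _ = tmS N
  exact Set.Subset.antisymm (convexHull_min (tm_subset N) (tmS_convex N)) (tm_superset N)
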